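/- arXiv:2506.10279 — 3 statements merged into one kernel-verified Lean document; each statement's English description precedes it below -/
import Mathlib

section
/- Let n ≥ 1, T > 0, and let F : ℝⁿ → ℝⁿ, x : ℝ → ℝⁿ be such that x has derivative F(x(t)) at every t ∈ [0, T) (i.e., HasDerivAt x (F(x t)) t). Let h : ℝⁿ → ℝ be differentiable, let α : ℝ → ℝ be strictly monotone increasing with α(0) = 0, and let ε > 0. Assume that for every t ∈ [0, T) the directional derivative satisfies Dh(x(t))(F(x(t))) ≥ −α(h(x(t))) + ε/2, and that h(x(0)) > 0. Then h(x(t)) > 0 for all t ∈ [0, T). -/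
/-- If `x` solves `ẋ = F(x)` on `[0, T)`, `h` is differentiable, `α` is strictly
monotone with `α 0 = 0`, and the robust CBF condition
`fderiv ℝ h (x t) (F (x t)) ≥ -α (h (x t)) + ε/2` holds on `[0, T)` with `h (x 0) > 0`,
then `h (x t) > 0` for all `t ∈ [0, T)`. -/
theorem barrier_positive_of_cbf
    (n : ℕ) (hn : 1 ≤ n) (T : ℝ) (hT : 0 < T)
    (F : EuclideanSpace ℝ (Fin n) → EuclideanSpace ℝ (Fin n))
    (x : ℝ → EuclideanSpace ℝ (Fin n))
    (h : EuclideanSpace ℝ (Fin n) → ℝ)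
    (hdiff : Differentiable ℝ h)
    (α : ℝ → ℝ) (hα : StrictMono α) (hα0 : α 0 = 0)
    (ε : ℝ) (hε : 0 < ε)
    (hx : ∀ t ∈ Set.Ico (0 : ℝ) T, HasDerivAt x (F (x t)) t)
    (hcbf : ∀ t ∈ Set.Ico (0 : ℝ) T,
      fderiv ℝ h (x t) (F (x t)) ≥ -α (h (x t)) + ε / 2)
    (h0 : h (x 0) > 0) :
    ∀ t ∈ Set.Ico (0 : ℝ) T, h (x t) > 0 := by
  intro t ht
  have hg : ∀ t ∈ Set.Ico (0 : ℝ) T,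
      HasDerivAt (fun t => h (x t)) (fderiv ℝ h (x t) (F (x t))) t := fun t ht =>
    (hdiff (x t)).hasFDerivAt.comp_hasDerivAt t (hx t ht)
  by_contra hneg
  have hsub : ∀ r ∈ Set.Icc (0 : ℝ) t, r ∈ Set.Ico (0 : ℝ) T := fun r hr =>
    ⟨hr.1, lt_of_le_of_lt hr.2 ht.2⟩
  have hc : ContinuousOn (fun t => h (x t)) (Set.Icc 0 t) := fun r hr =>
    (hg r (hsub r hr)).continuousAt.continuousWithinAt
  have hclosed := hc.preimage_isClosed_of_isClosed isClosed_Icc (isClosed_Iic (a := (0 : ℝ)))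
  have hcomp : IsCompact (Set.Icc 0 t ∩ (fun t => h (x t)) ⁻¹' Set.Iic 0) :=
    isCompact_Icc.of_isClosed_subset hclosed Set.inter_subset_left
  obtain ⟨s, ⟨hs, hs0⟩, hmin⟩ := hcomp.exists_isLeast ⟨t, ⟨ht.1, le_rfl⟩, not_lt.mp hneg⟩
  have hs0' : h (x s) ≤ 0 := hs0
  have hspos : 0 < s := by
    rcases hs.1.lt_or_eq with h1 | h1
    · exact h1
    · rw [← h1] at hs0'
      linarith
  have hα' : α (h (x s)) ≤ 0 := by
    rw [← hα0]
    exact hα.monotone hs0'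
  have hd : 0 < fderiv ℝ h (x s) (F (x s)) := by
    have := hcbf s (hsub s hs)
    linarith
  have hsl := (hasDerivAt_iff_tendsto_slope.mp (hg s (hsub s hs))).eventually (lt_mem_nhds hd)
  have hsl' : ∀ᶠ r in nhdsWithin s (Set.Iio s), 0 < slope (fun t => h (x t)) s r :=
    hsl.filter_mono (nhdsWithin_mono s (fun r hr => ne_of_lt hr))
  obtain ⟨r, hr1, hr2⟩ := (hsl'.and (Ioo_mem_nhdsLT hspos)).exists
  rw [slope_def_field] at hr1
  have hrs : r - s < 0 := by linarith [hr2.2]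
  have hlt : h (x r) - h (x s) < 0 := by
    by_contra hge
    exact absurd hr1 (not_lt.mpr (div_nonpos_of_nonneg_of_nonpos (not_lt.mp hge) hrs.le))
  have hr0 : h (x r) ≤ 0 := by linarith
  have := hmin ⟨⟨hr2.1.le, hr2.2.le.trans hs.2⟩, hr0⟩
  linarith
end

section
/- Let a < b be real numbers, let φ : ℝ → ℝ be differentiable on [a, b], let α : ℝ → ℝ be strictly monotone increasing with α(0) = 0, and let ε > 0. Assume φ′(t) ≥ −α(φ(t)) + ε/2 for all t ∈ [a, b]. If t̂ ∈ [a, b) satisfies α(φ(t̂)) < ε/2, then α(φ(t)) > α(φ(t̂)) for all t ∈ (t̂, b]. -/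
/-- If `φ` is differentiable on `[a, b]` with derivative `φ'`, `α` is strictly
monotone with `α 0 = 0`, and `φ' t ≥ -α (φ t) + ε/2` on `[a, b]`, then for any
`t₀ ∈ [a, b)` with `α (φ t₀) < ε/2` we have `α (φ t) > α (φ t₀)` for all `t ∈ (t₀, b]`. -/
theorem barrier_strictly_increasing_below_margin
    (a b : ℝ) (hab : a < b) (φ φ' : ℝ → ℝ)
    (hφ : ∀ t ∈ Set.Icc a b, HasDerivAt φ (φ' t) t)
    (α : ℝ → ℝ) (hα : StrictMono α) (hα0 : α 0 = 0)
    (ε : ℝ) (hε : 0 < ε)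
    (hcond : ∀ t ∈ Set.Icc a b, φ' t ≥ -α (φ t) + ε / 2)
    (t₀ : ℝ) (ht₀ : t₀ ∈ Set.Ico a b) (hlt : α (φ t₀) < ε / 2) :
    ∀ t ∈ Set.Ioc t₀ b, α (φ t) > α (φ t₀) := by
  intro t ht
  obtain ⟨ha0, h0b⟩ := ht₀
  obtain ⟨h0t, htb⟩ := ht
  by_contra hcon
  have hle : φ t ≤ φ t₀ := hα.le_iff_le.1 (not_lt.1 hcon)
  have key : ∀ m, t₀ < m → m ≤ t → φ m ≤ φ t₀ →
      ¬ (∀ s ∈ Set.Icc t₀ t, φ m ≤ φ s) := by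
    intro m hm hmt hmc hmin
    have hmem : m ∈ Set.Icc a b := ⟨by linarith, by linarith⟩
    have hpos : 0 < φ' m := by
      have h1 := hcond m hmem
      have h2 := hα.monotone hmc
      linarith
    have hs := (hasDerivAt_iff_tendsto_slope.1 (hφ m hmem)).eventually (lt_mem_nhds hpos)
    have hs' : ∀ᶠ s in nhdsWithin m (Set.Iio m), 0 < slope φ m s :=
      hs.filter_mono (nhdsWithin_mono m (fun s hs => ne_of_lt hs))
    obtain ⟨s, hs1, hs2⟩ := (hs'.and (Ioo_mem_nhdsLT hm)).exists
    have h3 := hmin s ⟨hs2.1.le, by linarith [hs2.2]⟩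
    rw [slope_def_field] at hs1
    have h4 : (φ s - φ m) / (s - m) ≤ 0 :=
      div_nonpos_of_nonneg_of_nonpos (by linarith) (by linarith [hs2.2])
    linarith
  have hcont : ContinuousOn φ (Set.Icc t₀ t) := fun s hs =>
    (hφ s ⟨by linarith [hs.1], by linarith [hs.2]⟩).continuousAt.continuousWithinAt
  obtain ⟨m, hm, hmin⟩ := isCompact_Icc.exists_isMinOn ⟨t, h0t.le, le_rfl⟩ hcont
  have hmin' : ∀ s ∈ Set.Icc t₀ t, φ m ≤ φ s := fun s hs => hmin hs
  rcases hm.1.eq_or_lt with h | h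
  · exact key t h0t le_rfl hle (fun s hs => by
      have := hmin' s hs
      rw [← h] at this
      linarith)
  · exact key m h hm.2 (hmin' t₀ ⟨le_rfl, h0t.le⟩) hmin'
end

section
/- Let a < b be real numbers, let φ : ℝ → ℝ be differentiable on [a, b], let α : ℝ → ℝ be strictly monotone increasing with α(0) = 0, and let ε > 0. Assume φ′(t) ≥ −α(φ(t)) + ε/2 for all t ∈ [a, b]. If t̂ ∈ [a, b] satisfies α(φ(t̂)) ≤ ε/2, then α(φ(t)) ≥ α(φ(t̂)) for all t ∈ [t̂, b]. -/
/-- If `φ` is differentiable on `[a, b]` with derivative `φ'`, `α` is strictly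
monotone with `α 0 = 0`, and `φ' t ≥ -α (φ t) + ε/2` on `[a, b]`, then for any
`t₀ ∈ [a, b]` with `α (φ t₀) ≤ ε/2` we have `α (φ t) ≥ α (φ t₀)` for all `t ∈ [t₀, b]`. -/
theorem barrier_nondecreasing_below_margin
    (a b : ℝ) (hab : a < b) (φ φ' : ℝ → ℝ)
    (hφ : ∀ t ∈ Set.Icc a b, HasDerivAt φ (φ' t) t)
    (α : ℝ → ℝ) (hα : StrictMono α) (hα0 : α 0 = 0)
    (ε : ℝ) (hε : 0 < ε)
    (hcond : ∀ t ∈ Set.Icc a b, φ' t ≥ -α (φ t) + ε / 2)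
    (t₀ : ℝ) (ht₀ : t₀ ∈ Set.Icc a b) (hle : α (φ t₀) ≤ ε / 2) :
    ∀ t ∈ Set.Icc t₀ b, α (φ t) ≥ α (φ t₀) := by
  intro t ht
  by_contra hlt
  have h1 : φ t < φ t₀ := hα.lt_iff_lt.mp (not_le.mp hlt)
  obtain ⟨c, hc1, hc2⟩ := exists_between h1
  have hsub : ∀ x, t₀ ≤ x → x ≤ b → x ∈ Set.Icc a b := fun x h h' => ⟨ht₀.1.trans h, h'⟩
  have key := image_le_of_deriv_right_lt_deriv_boundary' (f := fun x => -φ x)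
    (f' := fun x => -φ' x) (a := t₀) (b := b) (B := fun _ => -c) (B' := fun _ => 0)
    (fun x hx => (hφ x (hsub x hx.1 hx.2)).continuousAt.neg.continuousWithinAt)
    (fun x hx => (hφ x (hsub x hx.1 hx.2.le)).neg.hasDerivWithinAt)
    (by simpa using hc2.le) continuousOn_const
    (fun x _ => hasDerivWithinAt_const _ _ _)
    (fun x hx he => by
      have he' : φ x = c := neg_injective he
      have h2 := hcond x (hsub x hx.1 hx.2.le)
      have h3 := hα hc2
      rw [he'] at h2
      show -φ' x < 0
      linarith) ht
  have key' : -φ t ≤ -c := key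
  linarith
end
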